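/- arXiv:2001.03932 — 5 statements merged into one kernel-verified Lean document; each statement's English description precedes it below -/
import Mathlib

section
/- Let Γ be a countable group acting by measurable bijections on a measurable space K, let μ be a probability measure on Γ, and let ν be a μ-stationary probability measure on K. Suppose that sup_{g∈Γ} μ^{*n}(g) → 0 as n → ∞, and let ξ ∈ K be a point such that Σ_{g∈Γ} ν({g·ξ}) < ∞. Then ν({ξ}) = 0. -/
open MeasureTheory

open Classical in
/-- Convolution powers of a probability density on a group:
`μ^{*0} = δ_e` and `μ^{*(n+1)}(g) = Σ_h μ^{*n}(h)·μ(h⁻¹g)`. -/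
noncomputable def convPow {Γ : Type*} [Group Γ] (μ : Γ → ℝ) : ℕ → Γ → ℝ
  | 0 => fun g => if g = 1 then 1 else 0
  | n + 1 => fun g => ∑' h : Γ, convPow μ n h * μ (h⁻¹ * g)

theorem convPow_bounds {Γ : Type*} [Group Γ] (μ : Γ → ℝ) (hμ0 : ∀ g, 0 ≤ μ g)
    (hμ1 : ∑' g : Γ, μ g = 1) (n : ℕ) :
    ∀ g, 0 ≤ convPow μ n g ∧ convPow μ n g ≤ 1 ∧
      Summable (fun h : Γ => convPow μ n h * μ (h⁻¹ * g)) := by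
  have hs : Summable μ := by
    by_contra h
    rw [tsum_eq_zero_of_not_summable h] at hμ1
    exact zero_ne_one hμ1
  have hs' : ∀ g : Γ, Summable (fun h : Γ => μ (h⁻¹ * g)) := fun g =>
    ((Equiv.inv Γ).trans (Equiv.mulRight g)).summable_iff.2 hs
  have ht : ∀ g : Γ, ∑' h : Γ, μ (h⁻¹ * g) = 1 := fun g => by
    rw [← hμ1]
    exact ((Equiv.inv Γ).trans (Equiv.mulRight g)).tsum_eq μ
  have key : ∀ n, (∀ g, 0 ≤ convPow μ n g ∧ convPow μ n g ≤ 1) →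
      ∀ g, Summable (fun h : Γ => convPow μ n h * μ (h⁻¹ * g)) := fun n hn g =>
    Summable.of_nonneg_of_le (fun h => mul_nonneg (hn h).1 (hμ0 _))
      (fun h => mul_le_of_le_one_left (hμ0 _) (hn h).2) (hs' g)
  have main : ∀ g, 0 ≤ convPow μ n g ∧ convPow μ n g ≤ 1 := by
    induction n with
    | zero => intro g; simp only [convPow]; split_ifs <;> norm_num
    | succ n ih =>
      intro g
      simp only [convPow]
      refine ⟨tsum_nonneg fun h => mul_nonneg (ih h).1 (hμ0 _), ?_⟩
      rw [← ht g]
      exact (key n ih g).tsum_le_tsum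
        (fun h => mul_le_of_le_one_left (hμ0 _) (ih h).2) (hs' g)
  exact fun g => ⟨(main g).1, (main g).2, key n main g⟩

theorem convPow_harmonic {Γ : Type*} [Group Γ] (μ : Γ → ℝ) (hμ0 : ∀ g, 0 ≤ μ g)
    (hμ1 : ∑' g : Γ, μ g = 1) (f : Γ → ENNReal)
    (hf : ∀ h, f h = ∑' g : Γ, ENNReal.ofReal (μ g) * f (h * g)) (n : ℕ) :
    f 1 = ∑' g : Γ, ENNReal.ofReal (convPow μ n g) * f g := by
  induction n with
  | zero =>
    rw [tsum_eq_single 1]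
    · simp [convPow]
    · intro g hg
      simp [convPow, hg]
  | succ n ih =>
    have hb := convPow_bounds μ hμ0 hμ1 n
    rw [ih]
    calc ∑' h : Γ, ENNReal.ofReal (convPow μ n h) * f h
        = ∑' h : Γ, ∑' g : Γ, ENNReal.ofReal (convPow μ n h * μ (h⁻¹ * g)) * f g := by
          refine tsum_congr fun h => ?_
          rw [hf h, ← ENNReal.tsum_mul_left, ← (Equiv.mulLeft h).tsum_eq
            (fun g => ENNReal.ofReal (convPow μ n h * μ (h⁻¹ * g)) * f g)]
          refine tsum_congr fun g => ?_
          simp [ENNReal.ofReal_mul (hb h).1, mul_assoc]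
      _ = _ := by
          rw [ENNReal.tsum_comm]
          refine tsum_congr fun g => ?_
          rw [ENNReal.tsum_mul_right]
          simp only [convPow]
          rw [ENNReal.ofReal_tsum_of_nonneg (fun h => mul_nonneg (hb h).1 (hμ0 _)) (hb g).2.2]

/-- If `sup_g μ^{*n}(g) → 0` and `ξ` is a point whose `Γ`-orbit has
summable `ν`-masses, then a `μ`-stationary probability measure `ν` has no atom at `ξ`. -/
theorem stationary_measure_no_atom
    {Γ : Type*} [Group Γ] [Countable Γ]
    {K : Type*} [MeasurableSpace K] [MeasurableSingletonClass K] [MulAction Γ K]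
    (hact : ∀ g : Γ, Measurable fun x : K => g • x)
    (μ : Γ → ℝ) (hμ0 : ∀ g, 0 ≤ μ g) (hμ1 : ∑' g : Γ, μ g = 1)
    (ν : Measure K) [IsProbabilityMeasure ν]
    (hstat : ∀ A : Set K, MeasurableSet A →
      ν A = ∑' g : Γ, ENNReal.ofReal (μ g) * ν ((fun x : K => g • x) ⁻¹' A))
    (hsup : ∀ ε > (0 : ℝ), ∃ N : ℕ, ∀ n ≥ N, ∀ g : Γ, convPow μ n g ≤ ε)
    (ξ : K) (hsum : ∑' g : Γ, ν {g • ξ} ≠ ⊤) :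
    ν {ξ} = 0 := by
  have hf : ∀ h : Γ, ν {h⁻¹ • ξ} =
      ∑' g : Γ, ENNReal.ofReal (μ g) * ν {(h * g)⁻¹ • ξ} := by
    intro h
    rw [hstat _ (measurableSet_singleton _)]
    refine tsum_congr fun g => ?_
    congr 2
    ext x
    simp only [Set.mem_preimage, Set.mem_singleton_iff, mul_inv_rev, mul_smul]
    exact eq_inv_smul_iff.symm
  have H := convPow_harmonic μ hμ0 hμ1 (fun h => ν {h⁻¹ • ξ}) hf
  have hS : ∑' g : Γ, ν {g⁻¹ • ξ} = ∑' g : Γ, ν {g • ξ} :=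
    (Equiv.inv Γ).tsum_eq (fun g => ν {g • ξ})
  have hle : ∀ ε : ℝ, 0 < ε → ν {ξ} ≤ ENNReal.ofReal ε * ∑' g : Γ, ν {g • ξ} := by
    intro ε hε
    obtain ⟨N, hN⟩ := hsup ε hε
    have h1 := H N
    simp only [inv_one, one_smul] at h1
    rw [h1, ← hS, ← ENNReal.tsum_mul_left]
    exact ENNReal.tsum_le_tsum fun g => by
      gcongr
      exact hN N le_rfl g
  have hlim : Filter.Tendsto (fun ε : ℝ => ENNReal.ofReal ε * ∑' g : Γ, ν {g • ξ})
      (nhdsWithin 0 (Set.Ioi 0)) (nhds 0) := by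
    have h0 : Filter.Tendsto (fun ε : ℝ => ENNReal.ofReal ε) (nhdsWithin 0 (Set.Ioi 0))
        (nhds 0) := by
      have := (ENNReal.continuous_ofReal.tendsto 0).mono_left
        (nhdsWithin_le_nhds (s := Set.Ioi 0))
      simpa using this
    have := ENNReal.Tendsto.mul_const h0 (Or.inr hsum)
    simpa using this
  refine le_antisymm (ge_of_tendsto hlim ?_) bot_le
  filter_upwards [self_mem_nhdsWithin] with ε hε using hle ε hε
end

section
/- Let Y be a set and ρ : Y × Y → [0,∞) a symmetric kernel (ρ(x,y) = ρ(y,x)) such that ρ(x,y) ≤ (1+ε′)·max{ρ(x,z), ρ(z,y)} for all x,y,z ∈ Y, where 0 ≤ ε′ < √2 − 1. Define the chain pseudo-distance θ(x,y) = inf{ Σ_{i=1}^n ρ(x_i, x_{i+1}) : n ≥ 1, x_1 = x, x_{n+1} = y, x_2,…,x_n ∈ Y }. Then (1 − 2ε′)·ρ(x,y) ≤ θ(x,y) ≤ ρ(x,y) for all x,y ∈ Y. In particular, if moreover ρ(x,y) = 0 exactly when x = y, then θ is a metric on Y. -/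
/-- The chain pseudo-distance associated to a kernel `ρ`: the infimum over all finite
chains `x = x₁, x₂, …, x_{n+1} = y` of `Σ_{i=1}^n ρ(x_i, x_{i+1})`. -/
noncomputable def chainDist {Y : Type*} (ρ : Y → Y → ℝ) (x y : Y) : ℝ :=
  sInf {s : ℝ | ∃ l : List Y, 2 ≤ l.length ∧ l.head? = some x ∧ l.getLast? = some y ∧
    s = ((l.zip l.tail).map fun p => ρ p.1 p.2).sum}

/-- `ChainSum ρ x y s`: there is a chain with at least one step from `x` to `y` of total `s`. -/
inductive ChainSum {Y : Type*} (ρ : Y → Y → ℝ) : Y → Y → ℝ → Prop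
  | single (x y : Y) : ChainSum ρ x y (ρ x y)
  | cons (x y z : Y) (s : ℝ) : ChainSum ρ y z s → ChainSum ρ x z (ρ x y + s)

theorem ChainSum.append {Y : Type*} {ρ : Y → Y → ℝ} {x y z : Y} {s t : ℝ}
    (h : ChainSum ρ x y s) (h' : ChainSum ρ y z t) : ChainSum ρ x z (s + t) := by
  induction h with
  | single x y => exact .cons _ _ _ _ h'
  | cons x y w s _ ih => rw [add_assoc]; exact .cons _ _ _ _ (ih h')

theorem ChainSum.reverse {Y : Type*} {ρ : Y → Y → ℝ} (hsymm : ∀ x y, ρ x y = ρ y x)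
    {x y : Y} {s : ℝ} (h : ChainSum ρ x y s) : ChainSum ρ y x s := by
  induction h with
  | single x y => rw [hsymm]; exact .single _ _
  | cons x y w s _ ih => rw [add_comm, hsymm]; exact ih.append (.single _ _)

theorem ChainSum.nonneg {Y : Type*} {ρ : Y → Y → ℝ} (hn : ∀ x y, 0 ≤ ρ x y)
    {x y : Y} {s : ℝ} (h : ChainSum ρ x y s) : 0 ≤ s := by
  induction h with
  | single x y => exact hn _ _
  | cons x y w s _ ih => exact add_nonneg (hn _ _) ih

theorem ChainSum.exists_fun {Y : Type*} {ρ : Y → Y → ℝ}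
    {x y : Y} {s : ℝ} (h : ChainSum ρ x y s) :
    ∃ (n : ℕ) (f : ℕ → Y), 1 ≤ n ∧ f 0 = x ∧ f n = y ∧
      s = ∑ i ∈ Finset.range n, ρ (f i) (f (i + 1)) := by
  induction h with
  | single x y => exact ⟨1, fun i => if i = 0 then x else y, by simp⟩
  | cons x y w s _ ih =>
    obtain ⟨n, f, hn, h0, h1, hs⟩ := ih
    refine ⟨n + 1, fun i => Nat.casesOn i x f, by omega, rfl, h1, ?_⟩
    rw [Finset.sum_range_succ', add_comm, hs]
    simp [h0]

theorem chainSum_of_list {Y : Type*} (ρ : Y → Y → ℝ) (y : Y) (l : List Y) :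
    ∀ x z : Y, (x :: z :: l).getLast? = some y →
      ChainSum ρ x y ((((x :: z :: l).zip (z :: l)).map fun p => ρ p.1 p.2).sum) := by
  induction l with
  | nil =>
    intro x z h
    simp at h
    subst h
    simpa using ChainSum.single (ρ := ρ) x z
  | cons w l ih =>
    intro x z h
    have := ih z w (by simpa using h)
    simpa using ChainSum.cons x z y _ this

theorem chainDist_eq {Y : Type*} (ρ : Y → Y → ℝ) (x y : Y) :
    chainDist ρ x y = sInf {s | ChainSum ρ x y s} := by
  unfold chainDist
  congr 1
  ext s
  constructor
  · rintro ⟨l, hl, hx, hy, rfl⟩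
    match l, hl, hx, hy with
    | a :: b :: l, _, hx, hy =>
      simp at hx
      subst hx
      exact chainSum_of_list ρ y l a b hy
  · intro h
    change ChainSum ρ x y s at h
    induction h with
    | single x y => exact ⟨[x, y], by simp⟩
    | cons x y w s _ ih =>
      obtain ⟨l, hl, hx, hy, hs⟩ := ih
      match l, hl, hx, hy, hs with
      | a :: b :: l, _, hx, hy, hs =>
        simp at hx
        subst hx
        exact ⟨x :: a :: b :: l, by simp, by simp, by simpa using hy, by simp [hs]⟩

theorem chain_lower {Y : Type*} (ρ : Y → Y → ℝ) (e : ℝ) (he0 : 0 ≤ e)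
    (he1 : 0 < 1 - 2 * e) (he2 : (1 + e) ^ 2 ≤ 2)
    (hn : ∀ x y, 0 ≤ ρ x y)
    (hq : ∀ x y z, ρ x y ≤ (1 + e) * max (ρ x z) (ρ z y)) (n : ℕ) :
    ∀ f : ℕ → Y, 1 ≤ n →
      (1 - 2 * e) * ρ (f 0) (f n) ≤ ∑ i ∈ Finset.range n, ρ (f i) (f (i + 1)) := by
  induction n using Nat.strong_induction_on with
  | _ n ih =>
  intro f hn1
  set g : ℕ → ℝ := fun i => ρ (f i) (f (i + 1)) with hg
  set S := ∑ i ∈ Finset.range n, g i with hS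
  have hg0 : ∀ i, 0 ≤ g i := fun i => hn _ _
  have hS0 : 0 ≤ S := Finset.sum_nonneg fun i _ => hg0 i
  have hex : ∃ q, S / 2 ≤ ∑ i ∈ Finset.range (q + 1), g i :=
    ⟨n - 1, by rw [Nat.sub_add_cancel hn1]; linarith⟩
  classical
  obtain ⟨p, hp, hmin⟩ : ∃ p, S / 2 ≤ ∑ i ∈ Finset.range (p + 1), g i ∧
      ∀ q < p, ¬ S / 2 ≤ ∑ i ∈ Finset.range (q + 1), g i :=
    ⟨Nat.find hex, Nat.find_spec hex, fun q hq => Nat.find_min hex hq⟩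
  have hpn : p < n := by
    by_contra hc
    exact hmin (n - 1) (by omega) (by rw [Nat.sub_add_cancel hn1]; linarith)
  have hfirst : ∑ i ∈ Finset.range p, g i ≤ S / 2 := by
    rcases Nat.eq_zero_or_pos p with h | h
    · subst h; simp; linarith
    · have := hmin (p - 1) (by omega)
      rw [Nat.sub_add_cancel h] at this
      linarith
  have hmid : g p ≤ S :=
    Finset.single_le_sum (f := g) (fun i _ => hg0 i) (Finset.mem_range.2 hpn)
  obtain ⟨m, hm⟩ : ∃ m, n = (p + 1) + m := ⟨n - (p + 1), by omega⟩
  have hlast : ∑ i ∈ Finset.range m, g (p + 1 + i) ≤ S / 2 := by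
    have : S = ∑ i ∈ Finset.range (p + 1), g i + ∑ i ∈ Finset.range m, g (p + 1 + i) := by
      rw [hS, hm, Finset.sum_range_add]
    linarith
  -- the key bounds
  have hK : (1 - 2 * e) * (1 + e) ^ 2 ≤ 1 := by nlinarith [pow_nonneg he0 3, sq_nonneg e]
  set a := 1 - 2 * e with ha
  -- bound M on each of the three pieces
  set M := max S (S / (2 * a)) with hM
  have hM0 : 0 ≤ M := hS0.trans (le_max_left _ _)
  have half : ∀ r, a * r ≤ S / 2 → r ≤ M := fun r hr => by
    refine le_trans ?_ (le_max_right _ _)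
    rw [le_div_iff₀ (by positivity)]; linarith
  have hfin : a * ((1 + e) ^ 2 * M) ≤ S := by
    rcases max_choice S (S / (2 * a)) with h | h
    · rw [hM, h]; nlinarith
    · rw [hM, h]
      have : a * ((1 + e) ^ 2 * (S / (2 * a))) = (1 + e) ^ 2 * (S / 2) := by
        field_simp
      rw [this]; nlinarith
  have hA : ρ (f p) (f n) ≤ (1 + e) * M := by
    rcases Nat.eq_zero_or_pos m with h | h
    · have h1 : ρ (f p) (f n) ≤ M := by
        subst h; subst hm; exact hmid.trans (le_max_left _ _)
      nlinarith
    · refine (hq _ _ (f (p + 1))).trans ?_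
      refine mul_le_mul_of_nonneg_left (max_le (hmid.trans (le_max_left _ _)) ?_) (by linarith)
      apply half
      have := ih m (by omega) (fun i => f (p + 1 + i)) h
      rw [hm]
      exact this.trans hlast
  have hB : ρ (f 0) (f n) ≤ (1 + e) ^ 2 * M := by
    rcases Nat.eq_zero_or_pos p with h | h
    · subst h
      have : 0 ≤ (1 + e) * M := by positivity
      nlinarith
    · refine (hq _ _ (f p)).trans ?_
      rw [pow_two, mul_assoc]
      refine mul_le_mul_of_nonneg_left (max_le ?_ hA) (by linarith)
      have h1 : ρ (f 0) (f p) ≤ M := half _ ((ih p hpn f h).trans hfirst)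
      nlinarith
  exact (mul_le_mul_of_nonneg_left hB he1.le).trans hfin

/-- For a symmetric nonnegative kernel `ρ` satisfying the quasi-metric
inequality `ρ(x,y) ≤ (1+ε′)·max{ρ(x,z), ρ(z,y)}` with `0 ≤ ε′ < √2 − 1`, the chain
pseudo-distance `θ` satisfies `(1−2ε′)·ρ ≤ θ ≤ ρ`; in particular if `ρ` vanishes exactly
on the diagonal then `θ` is a metric. -/
theorem chainDist_comparison
    {Y : Type*} (ρ : Y → Y → ℝ) (ε' : ℝ) (hε'0 : 0 ≤ ε') (hε' : ε' < Real.sqrt 2 - 1)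
    (hnonneg : ∀ x y, 0 ≤ ρ x y) (hsymm : ∀ x y, ρ x y = ρ y x)
    (hquasi : ∀ x y z, ρ x y ≤ (1 + ε') * max (ρ x z) (ρ z y)) :
    (∀ x y, (1 - 2 * ε') * ρ x y ≤ chainDist ρ x y ∧ chainDist ρ x y ≤ ρ x y) ∧
    ((∀ x y, ρ x y = 0 ↔ x = y) →
      (∀ x y, chainDist ρ x y = 0 ↔ x = y) ∧
      (∀ x y, chainDist ρ x y = chainDist ρ y x) ∧
      (∀ x y z, chainDist ρ x z ≤ chainDist ρ x y + chainDist ρ y z)) := by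
  have hs2 : Real.sqrt 2 ^ 2 = 2 := Real.sq_sqrt (by norm_num)
  have hs0 : 0 ≤ Real.sqrt 2 := Real.sqrt_nonneg 2
  have he2 : (1 + ε') ^ 2 ≤ 2 := by nlinarith
  have he1 : 0 < 1 - 2 * ε' := by nlinarith
  have hbdd : ∀ x y, BddBelow {s | ChainSum ρ x y s} :=
    fun x y => ⟨0, fun s hs => ChainSum.nonneg hnonneg hs⟩
  have hne : ∀ x y, {s | ChainSum ρ x y s}.Nonempty := fun x y => ⟨_, ChainSum.single x y⟩
  have hmain : ∀ x y, (1 - 2 * ε') * ρ x y ≤ chainDist ρ x y ∧ chainDist ρ x y ≤ ρ x y := by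
    intro x y
    rw [chainDist_eq]
    refine ⟨le_csInf (hne x y) ?_, csInf_le (hbdd x y) (ChainSum.single x y)⟩
    intro s hs
    obtain ⟨n, f, hn, rfl, rfl, rfl⟩ := ChainSum.exists_fun hs
    exact chain_lower ρ ε' hε'0 he1 he2 hnonneg hquasi n f hn
  refine ⟨hmain, fun hz => ⟨fun x y => ⟨fun h => ?_, fun h => ?_⟩, fun x y => ?_, fun x y z => ?_⟩⟩
  · have h1 := (hmain x y).1
    rw [h] at h1
    have h2 := hnonneg x y
    exact (hz x y).1 (by nlinarith)
  · have h0 := (hz x y).2 h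
    have := hmain x y
    rw [h0] at this
    linarith [this.1, this.2]
  · rw [chainDist_eq, chainDist_eq]
    congr 1
    ext s
    exact ⟨fun h => ChainSum.reverse hsymm h, fun h => ChainSum.reverse hsymm h⟩
  · rw [chainDist_eq, chainDist_eq, chainDist_eq]
    rw [← sub_le_iff_le_add]
    refine le_csInf (hne x y) fun s hs => ?_
    rw [sub_le_comm]
    refine le_csInf (hne y z) fun t ht => ?_
    have := csInf_le (hbdd x z) (ChainSum.append hs ht)
    linarith
end

section
/- Let (K,d) be a metric space with 0 < diam K ≤ 1 and let ν be a Borel probability measure on K that is D-Ahlfors regular with constant C ≥ 1 and exponent D > 0 (i.e. C⁻¹·r^D ≤ ν(B(x,r)) ≤ C·r^D for all x ∈ K and 0 < r ≤ diam K). Then there exist C′ ≥ 1 and r₀ ∈ (0, diam K], depending only on C, D and diam K, such that for every ξ ∈ K and every r ∈ (0, r₀]: C′⁻¹·(1 + log(1/r)) ≤ ∫_{{η ∈ K : d(ξ,η) ≥ r}} d(ξ,η)^{−D} dν(η) ≤ C′·(1 + log(1/r)). -/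
open MeasureTheory Metric

section Helpers

variable {K : Type} [MetricSpace K] [MeasurableSpace K] [BorelSpace K] (ν : Measure K)
  [IsProbabilityMeasure ν]

lemma aux_meas (ξ : K) (r : ℝ) : MeasurableSet {η : K | r ≤ dist ξ η} :=
  (isClosed_le continuous_const (by fun_prop)).measurableSet

lemma aux_meas2 (ξ : K) (r s : ℝ) : MeasurableSet {η : K | r ≤ dist ξ η ∧ dist ξ η < s} :=
  (aux_meas ξ r).inter (isOpen_lt (continuous_const.dist continuous_id) continuous_const).measurableSet

lemma aux_int (ξ : K) (D r : ℝ) (hD : 0 < D) (hr : 0 < r) :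
    IntegrableOn (fun η : K => (dist ξ η) ^ (-D)) {η : K | r ≤ dist ξ η} ν := by
  refine Measure.integrableOn_of_bounded (M := r ^ (-D)) (measure_ne_top _ _) ?_ ?_
  · have : Measurable (fun η : K => (dist ξ η) ^ (-D)) :=
      (Continuous.measurable (by fun_prop : Continuous fun η : K => dist ξ η)).pow_const _
    exact this.aestronglyMeasurable
  · filter_upwards [ae_restrict_mem (aux_meas ξ r)] with η hη
    have h1 : r ≤ dist ξ η := hη
    rw [Real.norm_of_nonneg (by positivity)]
    exact Real.rpow_le_rpow_of_nonpos hr h1 (by linarith)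

lemma aux_split (ξ : K) (D r s : ℝ) (hD : 0 < D) (hr : 0 < r) (hs : r ≤ s) :
    ∫ η in {η : K | r ≤ dist ξ η}, (dist ξ η) ^ (-D) ∂ν =
      ∫ η in {η : K | r ≤ dist ξ η ∧ dist ξ η < s}, (dist ξ η) ^ (-D) ∂ν +
      ∫ η in {η : K | s ≤ dist ξ η}, (dist ξ η) ^ (-D) ∂ν := by
  rw [← setIntegral_union _ (aux_meas ξ s)
    ((aux_int ν ξ D r hD hr).mono_set fun η h => h.1)
    ((aux_int ν ξ D s hD (by linarith)))]
  · congr 2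
    ext η
    simp only [Set.mem_setOf_eq, Set.mem_union]
    constructor
    · intro h
      rcases lt_or_ge (dist ξ η) s with h' | h'
      · exact Or.inl ⟨h, h'⟩
      · exact Or.inr h'
    · rintro (h | h)
      · exact h.1
      · exact hs.trans h
  · rw [Set.disjoint_left]
    rintro η ⟨_, h⟩ h'
    exact absurd h (not_lt.mpr h')

/-- Upper bound on one annulus. -/
lemma aux_upper (ξ : K) (C D r l : ℝ) (hD : 0 < D) (hr : 0 < r) (hl : 1 < l)
    (hup : ∀ s : ℝ, 0 < s → ν.real (closedBall ξ s) ≤ C * s ^ D) :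
    ∫ η in {η : K | r ≤ dist ξ η ∧ dist ξ η < l * r}, (dist ξ η) ^ (-D) ∂ν ≤ C * l ^ D := by
  have h0 : 0 < l := by linarith
  have h1 : ∫ η in {η : K | r ≤ dist ξ η ∧ dist ξ η < l * r}, (dist ξ η) ^ (-D) ∂ν ≤
      ∫ η in {η : K | r ≤ dist ξ η ∧ dist ξ η < l * r}, r ^ (-D) ∂ν := by
    refine setIntegral_mono_on ((aux_int ν ξ D r hD hr).mono_set fun η h => h.1)
      (integrable_const _) (aux_meas2 ξ r _) ?_
    intro η hη
    exact Real.rpow_le_rpow_of_nonpos hr hη.1 (by linarith)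
  rw [setIntegral_const, smul_eq_mul] at h1
  have h2 : ν.real {η : K | r ≤ dist ξ η ∧ dist ξ η < l * r} ≤ C * (l * r) ^ D := by
    refine le_trans (measureReal_mono ?_) (hup (l * r) (by positivity))
    intro η hη
    rw [mem_closedBall']
    exact hη.2.le
  have h3 : C * (l * r) ^ D * r ^ (-D) = C * l ^ D := by
    rw [Real.mul_rpow h0.le hr.le, Real.rpow_neg hr.le]
    have : r ^ D ≠ 0 := by positivity
    field_simp
  calc _ ≤ _ := h1
    _ ≤ C * (l * r) ^ D * r ^ (-D) := by gcongr
    _ = _ := h3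

/-- Lower bound on one annulus. -/
lemma aux_lower (ξ : K) (C D r m : ℝ) (hC : 1 ≤ C) (hD : 0 < D) (hr : 0 < r) (hm : 1 < m)
    (hmD : m ^ D = C * (C + 1))
    (hup : ν.real (closedBall ξ r) ≤ C * r ^ D)
    (hlo : C⁻¹ * (m * r) ^ D ≤ ν.real (closedBall ξ (m * r))) :
    (2 * m) ^ (-D) ≤
      ∫ η in {η : K | r ≤ dist ξ η ∧ dist ξ η < 2 * m * r}, (dist ξ η) ^ (-D) ∂ν := by
  have h0 : 0 < m := by linarith
  have hmr : 0 < m * r := by positivity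
  have h1 : ∫ η in {η : K | r ≤ dist ξ η ∧ dist ξ η < 2 * m * r}, (2 * m * r) ^ (-D) ∂ν ≤
      ∫ η in {η : K | r ≤ dist ξ η ∧ dist ξ η < 2 * m * r}, (dist ξ η) ^ (-D) ∂ν := by
    refine setIntegral_mono_on (integrable_const _)
      ((aux_int ν ξ D r hD hr).mono_set fun η h => h.1) (aux_meas2 ξ r _) ?_
    intro η hη
    exact Real.rpow_le_rpow_of_nonpos (hr.trans_le hη.1) hη.2.le (by linarith)
  rw [setIntegral_const, smul_eq_mul] at h1
  have h2 : r ^ D ≤ ν.real {η : K | r ≤ dist ξ η ∧ dist ξ η < 2 * m * r} := by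
    have h3 : ν.real (closedBall ξ (m * r)) ≤ ν.real (closedBall ξ r) +
        ν.real {η : K | r ≤ dist ξ η ∧ dist ξ η < 2 * m * r} := by
      refine le_trans (measureReal_mono ?_) (measureReal_union_le _ _)
      intro η hη
      rw [mem_closedBall'] at hη
      rcases le_total (dist ξ η) r with h | h
      · left; rw [mem_closedBall']; exact h
      · right; exact ⟨h, by linarith⟩
    have h4 : C⁻¹ * (m * r) ^ D = (C + 1) * r ^ D := by
      rw [Real.mul_rpow h0.le hr.le, hmD]
      field_simp
    linarith
  refine le_trans ?_ h1
  have h3 : (2 * m) ^ (-D) = r ^ D * (2 * m * r) ^ (-D) := by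
    rw [Real.mul_rpow (by positivity) hr.le, Real.rpow_neg hr.le]
    have : r ^ D ≠ 0 := by positivity
    field_simp
  rw [h3]
  gcongr

end Helpers

/-- For a `D`-Ahlfors regular probability measure `ν` (constant `C`,
exponent `D > 0`) on a metric space of diameter `dK ∈ (0,1]`, there are `C′ ≥ 1` and
`r₀ ∈ (0, dK]`, depending only on `C`, `D` and `dK`, such that for every `ξ` and every
`0 < r ≤ r₀` one has
`C′⁻¹·(1 + log(1/r)) ≤ ∫_{d(ξ,η) ≥ r} d(ξ,η)^{-D} dν(η) ≤ C′·(1 + log(1/r))`. -/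
theorem ahlfors_regular_annulus_integral_log_bound
    (C D dK : ℝ) (hC : 1 ≤ C) (hD : 0 < D) (hdK0 : 0 < dK) (hdK1 : dK ≤ 1) :
    ∃ C' : ℝ, 1 ≤ C' ∧ ∃ r₀ : ℝ, 0 < r₀ ∧ r₀ ≤ dK ∧
      ∀ (K : Type) (_ : MetricSpace K) (mK : MeasurableSpace K), BorelSpace K →
        ∀ ν : Measure K, IsProbabilityMeasure ν →
        diam (Set.univ : Set K) = dK →
        (∀ (x : K) (r : ℝ), 0 < r → r ≤ dK →
          C⁻¹ * r ^ D ≤ (ν (closedBall x r)).toReal ∧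
            (ν (closedBall x r)).toReal ≤ C * r ^ D) →
        ∀ (ξ : K) (r : ℝ), 0 < r → r ≤ r₀ →
          C'⁻¹ * (1 + Real.log (1 / r)) ≤
              ∫ η in {η : K | r ≤ dist ξ η}, (dist ξ η) ^ (-D) ∂ν ∧
            ∫ η in {η : K | r ≤ dist ξ η}, (dist ξ η) ^ (-D) ∂ν ≤
              C' * (1 + Real.log (1 / r)) := by
  set m : ℝ := (C * (C + 1)) ^ (1 / D) with hm_def
  have hCC : 1 < C * (C + 1) := by nlinarith
  have hm : 1 < m := Real.one_lt_rpow hCC (by positivity)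
  have hmD : m ^ D = C * (C + 1) := by
    rw [hm_def, ← Real.rpow_mul (by positivity)]
    field_simp
    simp
  set l : ℝ := 2 * m with hl_def
  have hl : 1 < l := by linarith
  have hl0 : 0 < l := by linarith
  set L : ℝ := Real.log l with hL_def
  have hL : 0 < L := Real.log_pos hl
  set a : ℝ := l ^ (-D) with ha_def
  have ha : 0 < a := by positivity
  set b : ℝ := C * l ^ D with hb_def
  have hb : 0 < b := by positivity
  have hlogd : Real.log dK ≤ 0 := Real.log_nonpos hdK0.le hdK1
  set C' : ℝ := 1 + 2 * L / a + b * (1 / L + 1) with hC'_def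
  have hp1 : 0 < 2 * L / a := by positivity
  have hp2 : 0 < b * (1 / L + 1) := by positivity
  have hC'1 : 1 ≤ C' := by linarith
  refine ⟨C', hC'1, Real.exp (-(1 + 2 * L - 2 * Real.log dK)), Real.exp_pos _, ?_, ?_⟩
  · rw [← Real.le_log_iff_exp_le hdK0]
    linarith
  intro K _ mK _ ν _ hdiam hreg ξ r hr hr0
  have hbdd : Bornology.IsBounded (Set.univ : Set K) := by
    by_contra h
    rw [diam_eq_zero_of_unbounded h] at hdiam
    linarith
  have hdist : ∀ η : K, dist ξ η ≤ dK := fun η =>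
    hdiam ▸ dist_le_diam_of_mem hbdd (Set.mem_univ _) (Set.mem_univ _)
  have hup : ∀ s : ℝ, 0 < s → ν.real (closedBall ξ s) ≤ C * s ^ D := by
    intro s hs
    rcases le_total s dK with h | h
    · exact (hreg ξ s hs h).2
    · refine le_trans (measureReal_mono (s₂ := closedBall ξ dK) ?_) (le_trans (hreg ξ dK hdK0 le_rfl).2 ?_)
      · intro η _
        rw [mem_closedBall']
        exact hdist η
      · gcongr
  have hlow : ∀ n : ℕ, ∀ s : ℝ, 0 < s → l ^ n * s ≤ dK →
      n * a ≤ ∫ η in {η : K | s ≤ dist ξ η}, (dist ξ η) ^ (-D) ∂ν := by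
    intro n
    induction n with
    | zero =>
      intro s hs _
      simp only [Nat.cast_zero, zero_mul]
      exact integral_nonneg fun η => by positivity
    | succ n ih =>
      intro s hs hn
      have hls : s ≤ l * s := by nlinarith
      rw [aux_split ν ξ D s (l * s) hD hs hls]
      have h1 := ih (l * s) (by positivity) (by rw [← mul_assoc, ← pow_succ]; exact hn)
      have h5 : l * s ≤ dK := by
        refine le_trans ?_ hn
        gcongr
        exact le_self_pow₀ hl.le (by simp)
      have h6 : m * s ≤ l * s := by nlinarith
      have h2 := aux_lower ν ξ C D s m hC hD hs hm hmD (hup s hs)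
        (hreg ξ (m * s) (by positivity) (h6.trans h5)).1
      push_cast
      linarith
  have hupp : ∀ n : ℕ, ∀ s : ℝ, 0 < s → dK < l ^ n * s →
      ∫ η in {η : K | s ≤ dist ξ η}, (dist ξ η) ^ (-D) ∂ν ≤ n * b := by
    intro n
    induction n with
    | zero =>
      intro s hs hn
      have : {η : K | s ≤ dist ξ η} = ∅ := by
        ext η
        simp only [Set.mem_setOf_eq, Set.mem_empty_iff_false, iff_false, not_le]
        have := hdist η
        simp at hn
        linarith
      rw [this]
      simp
    | succ n ih =>
      intro s hs hn
      have hls : s ≤ l * s := by nlinarith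
      rw [aux_split ν ξ D s (l * s) hD hs hls]
      have h1 := ih (l * s) (by positivity) (by rw [← mul_assoc, ← pow_succ]; exact hn)
      have h2 := aux_upper ν ξ C D s l hD hs hl hup
      push_cast
      linarith
  have hlogr : Real.log r ≤ -(1 + 2 * L - 2 * Real.log dK) := (Real.log_le_iff_le_exp hr).mpr hr0
  have hx : Real.log (1 / r) = - Real.log r := by simp
  rw [hx]
  set x : ℝ := - Real.log r with hx_def
  have hx1 : 1 + 2 * L - 2 * Real.log dK ≤ x := by linarith
  have hx0 : 0 < x := by linarith
  have hy0 : 0 ≤ (x + Real.log dK) / L := div_nonneg (by linarith) hL.le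
  set n : ℕ := ⌊(x + Real.log dK) / L⌋₊ with hn_def
  have hn1 : (n : ℝ) ≤ (x + Real.log dK) / L := Nat.floor_le hy0
  have hn2 : (x + Real.log dK) / L < n + 1 := Nat.lt_floor_add_one _
  have hlog : ∀ k : ℕ, Real.log (l ^ k * r) = k * L - x := by
    intro k
    rw [Real.log_mul (by positivity) hr.ne', Real.log_pow]
    linarith
  constructor
  · have h1 := hlow n r hr (by
      rw [← Real.log_le_log_iff (by positivity) hdK0, hlog]
      rw [le_div_iff₀ hL] at hn1
      linarith)
    refine le_trans ?_ h1
    have h2 : (1 + x) / (2 * L) ≤ n := by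
      have : (1 + x) / (2 * L) + 1 ≤ (x + Real.log dK) / L := by
        rw [div_add_one (by positivity), div_le_div_iff₀ (by positivity) hL]
        nlinarith
      linarith
    calc C'⁻¹ * (1 + x) ≤ (2 * L / a)⁻¹ * (1 + x) := by
          gcongr
          linarith
      _ = (1 + x) / (2 * L) * a := by field_simp
      _ ≤ n * a := by gcongr
  · have h1 := hupp (n + 1) r hr (by
      rw [← Real.log_lt_log_iff hdK0 (by positivity), hlog]
      rw [div_lt_iff₀ hL] at hn2
      push_cast
      linarith)
    refine le_trans h1 ?_
    have h2 : (x + Real.log dK) / L ≤ x / L := by gcongr; linarith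
    have h3 : ((n + 1 : ℕ) : ℝ) ≤ (1 / L + 1) * (1 + x) := by
      push_cast
      have : (1 / L + 1) * (1 + x) = x / L + 1 + (1 / L + x) := by ring
      have : 0 < 1 / L := by positivity
      linarith
    calc ((n + 1 : ℕ) : ℝ) * b ≤ (1 / L + 1) * (1 + x) * b := by gcongr
      _ = (b * (1 / L + 1)) * (1 + x) := by ring
      _ ≤ C' * (1 + x) := by
        gcongr
        linarith
end

section
/- Let (K,d) be a metric space with 0 < diam K ≤ 1 and let ν be a Borel probability measure on K that is D-Ahlfors regular with constant C ≥ 1 and exponent D > 1. Let p ∈ K, T ≥ 0, A > 0, and let u : K → [0,∞) be a measurable function with ∫_K u dν ≤ 1 and u(ξ) ≤ A·d(p,ξ)^{−D}/(1+T) for ν-almost every ξ ≠ p. Then there is a constant C′, depending only on C, D and A, such that ∫_K d(p,ξ)·u(ξ) dν(ξ) ≤ C′·(1+T)^{−1/D}. -/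
open MeasureTheory Metric

lemma aux_kernel_bound (C D : ℝ) (hC : 1 ≤ C) (hD : 1 < D)
    (K : Type) [MetricSpace K] [MeasurableSpace K] [BorelSpace K]
    (ν : Measure K) [IsProbabilityMeasure ν]
    (p : K) (h1 : ∀ ξ : K, dist p ξ ≤ 1)
    (hball : ∀ r : ℝ, 0 < r → ν (closedBall p r) ≤ ENNReal.ofReal (C * r ^ D)) :
    ∫⁻ ξ, ENNReal.ofReal ((dist p ξ) ^ (1 - D)) ∂ν ≤ ENNReal.ofReal (C * 2 ^ (D - 1) * 2) := by
  have hpt : ∀ ξ : K, ENNReal.ofReal ((dist p ξ) ^ (1 - D)) ≤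
      ∑' k : ℕ, (closedBall p ((1 / 2 : ℝ) ^ k)).indicator
        (fun _ => ENNReal.ofReal (((1 / 2 : ℝ) ^ (k + 1)) ^ (1 - D))) ξ := by
    intro ξ
    rcases eq_or_lt_of_le (dist_nonneg (x := p) (y := ξ)) with h0 | h0
    · rw [← h0, Real.zero_rpow (by linarith)]
      simp
    · obtain ⟨n, hn1, hn2⟩ := exists_nat_pow_near_of_lt_one h0 (h1 ξ)
        (by norm_num : (0 : ℝ) < 1 / 2) (by norm_num)
      refine le_trans ?_ (ENNReal.le_tsum n)
      rw [Set.indicator_of_mem (by rw [mem_closedBall, dist_comm]; exact hn2)]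
      apply ENNReal.ofReal_le_ofReal
      exact Real.rpow_le_rpow_of_nonpos (by positivity) hn1.le (by linarith)
  have hsum : HasSum (fun k : ℕ => C * 2 ^ (D - 1) * (1 / 2 : ℝ) ^ k) (C * 2 ^ (D - 1) * 2) :=
    hasSum_geometric_two.mul_left _
  calc _ ≤ ∫⁻ ξ, ∑' k : ℕ, (closedBall p ((1 / 2 : ℝ) ^ k)).indicator
        (fun _ => ENNReal.ofReal (((1 / 2 : ℝ) ^ (k + 1)) ^ (1 - D))) ξ ∂ν := lintegral_mono hpt
    _ = ∑' k : ℕ, ENNReal.ofReal (((1 / 2 : ℝ) ^ (k + 1)) ^ (1 - D)) *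
          ν (closedBall p ((1 / 2 : ℝ) ^ k)) := by
        rw [lintegral_tsum]
        · congr 1
          ext k
          rw [lintegral_indicator_const isClosed_closedBall.measurableSet]
        · intro k
          exact (measurable_const.indicator isClosed_closedBall.measurableSet).aemeasurable
    _ ≤ ∑' k : ℕ, ENNReal.ofReal (C * 2 ^ (D - 1) * (1 / 2 : ℝ) ^ k) := by
        refine ENNReal.tsum_le_tsum fun k => ?_
        refine (mul_le_mul_right (hball _ (by positivity)) _).trans ?_
        rw [← ENNReal.ofReal_mul (by positivity)]
        apply ENNReal.ofReal_le_ofReal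
        apply le_of_eq
        rw [pow_succ]
        have ha : (0 : ℝ) < (1 / 2 : ℝ) ^ k := by positivity
        generalize (1 / 2 : ℝ) ^ k = a at ha
        rw [Real.mul_rpow ha.le (by norm_num)]
        have e1 : (1 / 2 : ℝ) ^ (1 - D) = 2 ^ (D - 1) := by
          rw [one_div, Real.inv_rpow (by norm_num), ← Real.rpow_neg (by norm_num)]
          congr 1
          ring
        have e2 : a ^ (1 - D) * a ^ D = a := by
          rw [← Real.rpow_add ha]
          simp
        rw [e1]
        linear_combination (C * 2 ^ (D - 1)) * e2
    _ = _ := by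
        rw [← ENNReal.ofReal_tsum_of_nonneg (fun k => by positivity) hsum.summable, hsum.tsum_eq]

/-- Let `ν` be `D`-Ahlfors regular (constant `C`, exponent `D > 1`) on
a metric space of diameter in `(0,1]`. If `u ≥ 0` has `∫ u dν ≤ 1` and
`u(ξ) ≤ A·d(p,ξ)^{-D}/(1+T)` a.e. off `p`, then `∫ d(p,ξ)·u(ξ) dν(ξ) ≤ C′·(1+T)^{-1/D}`
for a constant `C′` depending only on `C`, `D` and `A`. -/
theorem dirac_approximation_first_moment_bound
    (C D A : ℝ) (hC : 1 ≤ C) (hD : 1 < D) (hA : 0 < A) :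
    ∃ C' : ℝ, 0 < C' ∧
      ∀ (K : Type) (_ : MetricSpace K) (_ : MeasurableSpace K), BorelSpace K →
        ∀ ν : Measure K, IsProbabilityMeasure ν →
        0 < diam (Set.univ : Set K) → diam (Set.univ : Set K) ≤ 1 →
        (∀ (x : K) (r : ℝ), 0 < r → r ≤ diam (Set.univ : Set K) →
          C⁻¹ * r ^ D ≤ (ν (closedBall x r)).toReal ∧
            (ν (closedBall x r)).toReal ≤ C * r ^ D) →
        ∀ (p : K) (T : ℝ), 0 ≤ T →
        ∀ u : K → ℝ, Measurable u → (∀ ξ, 0 ≤ u ξ) →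
        (∫ ξ, u ξ ∂ν) ≤ 1 →
        (∀ᵐ ξ ∂ν, ξ ≠ p → u ξ ≤ A * (dist p ξ) ^ (-D) / (1 + T)) →
        ∫ ξ, dist p ξ * u ξ ∂ν ≤ C' * (1 + T) ^ (-(1 / D)) := by
  refine ⟨A * (C * 2 ^ (D - 1) * 2), by positivity, ?_⟩
  intro K _ _ _ ν _ hd0 hd1 hreg p T hT u hu hu0 _ hub
  have hbd : Bornology.IsBounded (Set.univ : Set K) := by
    by_contra h
    rw [diam_eq_zero_of_unbounded h] at hd0
    exact lt_irrefl _ hd0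
  have hdist : ∀ ξ : K, dist p ξ ≤ diam (Set.univ : Set K) := fun ξ =>
    dist_le_diam_of_mem hbd (Set.mem_univ _) (Set.mem_univ _)
  have hball : ∀ r : ℝ, 0 < r → ν (closedBall p r) ≤ ENNReal.ofReal (C * r ^ D) := by
    intro r hr
    rw [← ENNReal.ofReal_toReal (measure_ne_top ν (closedBall p r))]
    apply ENNReal.ofReal_le_ofReal
    rcases le_total r (diam (Set.univ : Set K)) with h | h
    · exact (hreg p r hr h).2
    · have hsub : closedBall p r ⊆ closedBall p (diam (Set.univ : Set K)) := by
        intro ξ _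
        rw [mem_closedBall, dist_comm]
        exact hdist ξ
      calc (ν (closedBall p r)).toReal ≤ (ν (closedBall p (diam (Set.univ : Set K)))).toReal :=
            ENNReal.toReal_mono (measure_ne_top _ _) (measure_mono hsub)
        _ ≤ C * (diam (Set.univ : Set K)) ^ D := (hreg p _ hd0 le_rfl).2
        _ ≤ C * r ^ D := by gcongr
  have hker := aux_kernel_bound C D hC hD K ν p (fun ξ => (hdist ξ).trans hd1) hball
  have hT1 : (0 : ℝ) < 1 + T := by linarith
  have hmeas : Measurable (fun ξ => dist p ξ) :=
    (continuous_const.dist continuous_id).measurable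
  have hM : (0 : ℝ) ≤ C * 2 ^ (D - 1) * 2 := by positivity
  have hpt : ∀ᵐ ξ ∂ν, ENNReal.ofReal (dist p ξ * u ξ) ≤
      ENNReal.ofReal (A / (1 + T)) * ENNReal.ofReal ((dist p ξ) ^ (1 - D)) := by
    filter_upwards [hub] with ξ hξ
    rw [← ENNReal.ofReal_mul (by positivity)]
    apply ENNReal.ofReal_le_ofReal
    by_cases h : ξ = p
    · subst h
      rw [dist_self, zero_mul]
      positivity
    · have hpos : 0 < dist p ξ := dist_pos.2 (Ne.symm h)
      calc dist p ξ * u ξ ≤ dist p ξ * (A * (dist p ξ) ^ (-D) / (1 + T)) := by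
            gcongr
            exact hξ h
        _ = A / (1 + T) * (dist p ξ) ^ (1 - D) := by
            rw [sub_eq_add_neg, Real.rpow_add hpos, Real.rpow_one]
            ring
  have hmain : ∫ ξ, dist p ξ * u ξ ∂ν ≤ A / (1 + T) * (C * 2 ^ (D - 1) * 2) := by
    rw [integral_eq_lintegral_of_nonneg_ae
      (Filter.Eventually.of_forall fun ξ => mul_nonneg dist_nonneg (hu0 ξ))
      (hmeas.mul hu).aestronglyMeasurable]
    apply ENNReal.toReal_le_of_le_ofReal (by positivity)
    refine (lintegral_mono_ae hpt).trans ?_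
    rw [lintegral_const_mul _ (hmeas.pow_const _).ennreal_ofReal,
      ENNReal.ofReal_mul (by positivity)]
    gcongr
  have hpow : (1 + T)⁻¹ ≤ (1 + T) ^ (-(1 / D)) := by
    rw [← Real.rpow_neg_one]
    apply Real.rpow_le_rpow_of_exponent_le (by linarith)
    have : 1 / D ≤ 1 := by
      rw [div_le_one (by linarith)]
      exact hD.le
    linarith
  calc _ ≤ _ := hmain
    _ = A * (C * 2 ^ (D - 1) * 2) * (1 + T)⁻¹ := by ring
    _ ≤ _ := by gcongr
end

section
/- Let (K,d) be a metric space with 0 < diam K ≤ 1 and let ν be a Borel probability measure on K that is D-Ahlfors regular with constant C ≥ 1 and exponent D > 1. Let p, q ∈ K, T ≥ 0, A > 0, and let u, v : K → [0,∞) be measurable with ∫_K u dν = ∫_K v dν = 1, u(ξ) ≤ A·d(p,ξ)^{−D}/(1+T) for ν-a.e. ξ ≠ p, and v(η) ≤ A·d(q,η)^{−D}/(1+T) for ν-a.e. η ≠ q. Let Ψ : K × K → ℝ be Lipschitz with constant λ(Ψ) for the ℓ¹ product metric d((ξ,η),(ξ′,η′)) = d(ξ,ξ′) + d(η,η′). Then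 there is a constant C′, depending only on C, D and A, such that | ∫_K ∫_K Ψ(ξ,η)·u(ξ)·v(η) dν(ξ) dν(η) − Ψ(p,q) | ≤ C′·λ(Ψ)·(1+T)^{−1/D}. -/
open MeasureTheory Metric

theorem aux_integrable {K : Type} [MetricSpace K] [MeasurableSpace K] [BorelSpace K]
    (ν : Measure K) (hb : ∀ x y : K, dist x y ≤ 1)
    (p : K) (w : K → ℝ) (hw0 : ∀ x, 0 ≤ w x) (hw1 : (∫ x, w x ∂ν) = 1)
    (f : K → ℝ) (hf : Continuous f) (a b c : ℝ) (ha : 0 ≤ a)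
    (h : ∀ x, |f x - c| ≤ a * dist p x + b) :
    Integrable (fun x => f x * w x) ν ∧
      |(∫ x, f x * w x ∂ν) - c| ≤ a * (∫ x, dist p x * w x ∂ν) + b := by
  have hwi : Integrable w ν := by
    by_contra hn
    rw [integral_undef hn] at hw1
    norm_num at hw1
  have hdi : Integrable (fun x => dist p x * w x) ν := by
    refine hwi.bdd_mul (c := 1) (by fun_prop : Continuous fun x => dist p x).aestronglyMeasurable ?_
    exact Filter.Eventually.of_forall fun x => by simpa using hb p x
  have hfi : Integrable (fun x => f x * w x) ν := by
    refine hwi.bdd_mul (c := a + b + |c|) hf.aestronglyMeasurable ?_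
    refine Filter.Eventually.of_forall fun x => ?_
    have h1 := h x
    have h2 : a * dist p x ≤ a * 1 := mul_le_mul_of_nonneg_left (hb p x) ha
    have h3 : |f x| ≤ |f x - c| + |c| := by
      simpa using abs_add_le (f x - c) c
    rw [Real.norm_eq_abs]
    linarith
  refine ⟨hfi, ?_⟩
  have e : (∫ x, f x * w x ∂ν) - c = ∫ x, (f x * w x - c * w x) ∂ν := by
    rw [integral_sub hfi (hwi.const_mul c), integral_const_mul, hw1, mul_one]
  have e2 : a * (∫ x, dist p x * w x ∂ν) + b = ∫ x, (a * (dist p x * w x) + b * w x) ∂ν := by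
    rw [integral_add (hdi.const_mul a) (hwi.const_mul b), integral_const_mul,
      integral_const_mul, hw1, mul_one]
  rw [e, e2, ← Real.norm_eq_abs]
  refine norm_integral_le_of_norm_le ((hdi.const_mul a).add (hwi.const_mul b)) ?_
  refine Filter.Eventually.of_forall fun x => ?_
  rw [Real.norm_eq_abs, ← sub_mul, abs_mul, abs_of_nonneg (hw0 x)]
  have := mul_le_mul_of_nonneg_right (h x) (hw0 x)
  linarith

theorem aux_kernel {K : Type} [MetricSpace K] [MeasurableSpace K] [BorelSpace K]
    (ν : Measure K) [IsProbabilityMeasure ν] (hb : ∀ x y : K, dist x y ≤ 1)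
    (C D : ℝ) (hC : 1 ≤ C) (hD : 1 < D) (p : K)
    (hr : ∀ r : ℝ, 0 < r → (ν (closedBall p r)).toReal ≤ C * r ^ D) :
    (∫⁻ x, ENNReal.ofReal (dist p x * dist p x ^ (-D)) ∂ν) ≤ ENNReal.ofReal (C * 2 ^ D) := by
  have hpt : ∀ x, ENNReal.ofReal (dist p x * dist p x ^ (-D)) ≤
      ∑' k : ℕ, (closedBall p ((1/2 : ℝ) ^ k)).indicator
        (fun _ => ENNReal.ofReal (((1/2 : ℝ) ^ (k+1)) ^ (1 - D))) x := by
    intro x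
    rcases (dist_nonneg (x := p) (y := x)).eq_or_lt with h0 | h0
    · rw [← h0]; simp
    · obtain ⟨n, hn1, hn2⟩ := exists_nat_pow_near_of_lt_one h0 (hb p x)
        (by norm_num : (0:ℝ) < 1/2) (by norm_num)
      refine le_trans ?_ (ENNReal.le_tsum n)
      rw [Set.indicator_of_mem (by rw [mem_closedBall, dist_comm]; exact hn2)]
      apply ENNReal.ofReal_le_ofReal
      have : dist p x * dist p x ^ (-D) = dist p x ^ (1 - D) := by
        rw [sub_eq_add_neg, Real.rpow_add h0, Real.rpow_one]
      rw [this]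
      exact Real.rpow_le_rpow_of_nonpos (by positivity) hn1.le (by linarith)
  refine (lintegral_mono hpt).trans ?_
  rw [lintegral_tsum (fun k => (measurable_const.indicator measurableSet_closedBall).aemeasurable)]
  have hk : ∀ k : ℕ, (∫⁻ x, (closedBall p ((1/2 : ℝ) ^ k)).indicator
        (fun _ => ENNReal.ofReal (((1/2 : ℝ) ^ (k+1)) ^ (1 - D))) x ∂ν) ≤
        ENNReal.ofReal (C * 2 ^ D * ((1/2) * (1/2 : ℝ) ^ k)) := by
    intro k
    rw [lintegral_indicator_const measurableSet_closedBall,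
      ← ENNReal.ofReal_toReal (measure_ne_top ν (closedBall p ((1/2 : ℝ) ^ k))),
      ← ENNReal.ofReal_mul (by positivity)]
    apply ENNReal.ofReal_le_ofReal
    have hp : (0:ℝ) < (1/2) ^ k := by positivity
    have h1 := mul_le_mul_of_nonneg_left (hr _ hp)
      (by positivity : (0:ℝ) ≤ ((1/2 : ℝ) ^ (k+1)) ^ (1 - D))
    refine h1.trans (le_of_eq ?_)
    rw [pow_succ, Real.mul_rpow hp.le (by norm_num)]
    have h2 : ((1/2:ℝ) ^ k) ^ (1 - D) * ((1/2:ℝ) ^ k) ^ D = (1/2:ℝ) ^ k := by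
      rw [← Real.rpow_add hp]; simp
    have h3 : (1/2:ℝ) ^ (1 - D) = 1/2 * 2 ^ D := by
      rw [Real.rpow_sub (by norm_num), Real.rpow_one, Real.div_rpow (by norm_num) (by norm_num),
        Real.one_rpow]
      field_simp
    rw [h3]
    linear_combination (C * (1/2) * 2 ^ D) * h2
  refine (ENNReal.tsum_le_tsum hk).trans ?_
  have hs : HasSum (fun k : ℕ => C * 2 ^ D * ((1/2) * (1/2 : ℝ) ^ k)) (C * 2 ^ D) := by
    have h := (hasSum_geometric_two.mul_left (1/2:ℝ)).mul_left (C * 2 ^ D)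
    have e : C * 2 ^ D * ((1/2 : ℝ) * 2) = C * 2 ^ D := by ring
    rw [e] at h
    exact h
  have hC0 : 0 ≤ C := by linarith
  rw [← ENNReal.ofReal_tsum_of_nonneg (fun k => by positivity) hs.summable, hs.tsum_eq]

theorem aux_moment {K : Type} [MetricSpace K] [MeasurableSpace K] [BorelSpace K]
    (ν : Measure K) [IsProbabilityMeasure ν] (hb : ∀ x y : K, dist x y ≤ 1)
    (C D A T : ℝ) (hC : 1 ≤ C) (hD : 1 < D) (hA : 0 < A) (hT : 0 ≤ T) (p : K)
    (hr : ∀ r : ℝ, 0 < r → (ν (closedBall p r)).toReal ≤ C * r ^ D)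
    (w : K → ℝ) (hwm : Measurable w) (hw0 : ∀ x, 0 ≤ w x)
    (hw : ∀ᵐ x ∂ν, x ≠ p → w x ≤ A * (dist p x) ^ (-D) / (1 + T)) :
    (∫ x, dist p x * w x ∂ν) ≤ A * (C * 2 ^ D) * (1 + T) ^ (-(1 / D)) := by
  have hC0 : 0 ≤ C := by linarith
  have hdm : Measurable fun x => dist p x := (by fun_prop : Continuous fun x => dist p x).measurable
  have h1 : (∫ x, dist p x * w x ∂ν) ≤ A / (1 + T) * (C * 2 ^ D) := by
    rw [integral_eq_lintegral_of_nonneg_ae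
      (Filter.Eventually.of_forall fun x => mul_nonneg dist_nonneg (hw0 x))
      (hdm.mul hwm).aestronglyMeasurable]
    refine ENNReal.toReal_le_of_le_ofReal (by positivity) ?_
    rw [ENNReal.ofReal_mul (by positivity)]
    refine le_trans ?_ (mul_le_mul_right (aux_kernel ν hb C D hC hD p hr) _)
    rw [← lintegral_const_mul' _ _ ENNReal.ofReal_ne_top]
    refine lintegral_mono_ae ?_
    filter_upwards [hw] with x hx
    rw [← ENNReal.ofReal_mul (by positivity)]
    apply ENNReal.ofReal_le_ofReal
    by_cases hxp : x = p
    · simp [hxp]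
    · have := mul_le_mul_of_nonneg_left (hx hxp) (dist_nonneg (x := p) (y := x))
      refine this.trans (le_of_eq ?_)
      ring
  refine h1.trans ?_
  have h2 : (1 + T)⁻¹ ≤ (1 + T) ^ (-(1 / D)) := by
    rw [← Real.rpow_neg_one]
    apply Real.rpow_le_rpow_of_exponent_le (by linarith)
    have : 1 / D ≤ 1 := by rw [div_le_one (by linarith)]; linarith
    linarith
  calc A / (1 + T) * (C * 2 ^ D) = A * (C * 2 ^ D) * (1 + T)⁻¹ := by ring
    _ ≤ _ := mul_le_mul_of_nonneg_left h2 (by positivity)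

/-- Quantitative weak-* convergence to a Dirac mass at `(p,q)`: for
`D`-Ahlfors regular `ν` (`D > 1`), densities `u, v` integrating to `1` and dominated by
`A·d(p,·)^{-D}/(1+T)` resp. `A·d(q,·)^{-D}/(1+T)`, and `Ψ` Lipschitz for the `ℓ¹`
product metric, `|∫∫ Ψ(ξ,η) u(ξ) v(η) dν dν − Ψ(p,q)| ≤ C′·λ(Ψ)·(1+T)^{-1/D}` with `C′`
depending only on `C`, `D`, `A`. -/
theorem lipschitz_test_against_dirac_approximation
    (C D A : ℝ) (hC : 1 ≤ C) (hD : 1 < D) (hA : 0 < A) :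
    ∃ C' : ℝ, 0 < C' ∧
      ∀ (K : Type) (_ : MetricSpace K) (_ : MeasurableSpace K), BorelSpace K →
        ∀ ν : Measure K, IsProbabilityMeasure ν →
        0 < diam (Set.univ : Set K) → diam (Set.univ : Set K) ≤ 1 →
        (∀ (x : K) (r : ℝ), 0 < r → r ≤ diam (Set.univ : Set K) →
          C⁻¹ * r ^ D ≤ (ν (closedBall x r)).toReal ∧
            (ν (closedBall x r)).toReal ≤ C * r ^ D) →
        ∀ (p q : K) (T : ℝ), 0 ≤ T →
        ∀ u v : K → ℝ, Measurable u → Measurable v →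
        (∀ ξ, 0 ≤ u ξ) → (∀ η, 0 ≤ v η) →
        (∫ ξ, u ξ ∂ν) = 1 → (∫ η, v η ∂ν) = 1 →
        (∀ᵐ ξ ∂ν, ξ ≠ p → u ξ ≤ A * (dist p ξ) ^ (-D) / (1 + T)) →
        (∀ᵐ η ∂ν, η ≠ q → v η ≤ A * (dist q η) ^ (-D) / (1 + T)) →
        ∀ (Ψ : K × K → ℝ) (lam : ℝ), 0 ≤ lam →
        (∀ x y : K × K, |Ψ x - Ψ y| ≤ lam * (dist x.1 y.1 + dist x.2 y.2)) →
        |(∫ ξ, ∫ η, Ψ (ξ, η) * u ξ * v η ∂ν ∂ν) - Ψ (p, q)| ≤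
          C' * lam * (1 + T) ^ (-(1 / D)) := by
  have hC0 : 0 < C := by linarith
  refine ⟨2 * (A * (C * 2 ^ D)), by positivity, ?_⟩
  intro K _ _ _ ν _ hd0 hd1 hreg p q T hT u v hum hvm hu0 hv0 hu1 hv1 hu hv Ψ lam hlam hΨ
  have hbd : Bornology.IsBounded (Set.univ : Set K) := by
    by_contra hn
    rw [diam_eq_zero_of_unbounded hn] at hd0
    exact lt_irrefl _ hd0
  have hdd : ∀ x y : K, dist x y ≤ diam (Set.univ : Set K) := fun x y =>
    dist_le_diam_of_mem hbd (Set.mem_univ x) (Set.mem_univ y)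
  have hb : ∀ x y : K, dist x y ≤ 1 := fun x y => (hdd x y).trans hd1
  have hr : ∀ (x : K) (r : ℝ), 0 < r → (ν (closedBall x r)).toReal ≤ C * r ^ D := by
    intro x r h0
    rcases le_total r (diam (Set.univ : Set K)) with h | h
    · exact (hreg x r h0 h).2
    · have e : closedBall x r = closedBall x (diam (Set.univ : Set K)) := by
        ext y
        simp only [mem_closedBall]
        exact ⟨fun _ => hdd y x, fun h' => h'.trans h⟩
      rw [e]
      refine (hreg x _ hd0 le_rfl).2.trans ?_
      exact mul_le_mul_of_nonneg_left (Real.rpow_le_rpow hd0.le h (by linarith)) hC0.le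
  have hIp := aux_moment ν hb C D A T hC hD hA hT p (hr p) u hum hu0 hu
  have hIq := aux_moment ν hb C D A T hC hD hA hT q (hr q) v hvm hv0 hv
  have hc2 : ∀ ξ, Continuous fun η => Ψ (ξ, η) := by
    intro ξ
    refine (LipschitzWith.of_dist_le_mul (K := lam.toNNReal) fun x y => ?_).continuous
    rw [Real.coe_toNNReal _ hlam]
    have := hΨ (ξ, x) (ξ, y)
    simpa [Real.dist_eq] using this
  have hF1 := fun ξ => aux_integrable ν hb q v hv0 hv1 (fun η => Ψ (ξ, η)) (hc2 ξ) lam 0 (Ψ (ξ, q))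
    hlam (fun x => by simpa [dist_comm] using hΨ (ξ, x) (ξ, q))
  have hFc : Continuous fun ξ => ∫ η, Ψ (ξ, η) * v η ∂ν := by
    refine (LipschitzWith.of_dist_le_mul (K := lam.toNNReal) fun x y => ?_).continuous
    rw [Real.coe_toNNReal _ hlam]
    have := (aux_integrable ν hb q v hv0 hv1 (fun η => Ψ (x, η) - Ψ (y, η))
      ((hc2 x).sub (hc2 y)) 0 (lam * dist x y) 0 le_rfl
      (fun z => by simpa using hΨ (x, z) (y, z))).2
    simp only [sub_mul] at this
    rw [integral_sub (hF1 x).1 (hF1 y).1] at this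
    simpa [Real.dist_eq] using this
  have hfin := (aux_integrable ν hb p u hu0 hu1 _ hFc lam (lam * ∫ η, dist q η * v η ∂ν) (Ψ (p, q))
    hlam (fun ξ => by
      have h1 := (hF1 ξ).2
      have h2 : |Ψ (ξ, q) - Ψ (p, q)| ≤ lam * dist p ξ := by
        simpa [dist_comm] using hΨ (ξ, q) (p, q)
      have h3 := abs_sub_le (∫ η, Ψ (ξ, η) * v η ∂ν) (Ψ (ξ, q)) (Ψ (p, q))
      linarith)).2
  have e : (∫ ξ, ∫ η, Ψ (ξ, η) * u ξ * v η ∂ν ∂ν) = ∫ ξ, (∫ η, Ψ (ξ, η) * v η ∂ν) * u ξ ∂ν := by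
    congr 1
    ext ξ
    rw [← integral_mul_const]
    congr 1
    ext η
    ring
  rw [e]
  refine hfin.trans ?_
  have h1 := mul_le_mul_of_nonneg_left hIp hlam
  have h2 := mul_le_mul_of_nonneg_left hIq hlam
  linarith
end
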